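/- Under the standing hypotheses on q, λ, Φ_q, Φ_{q+λ}, W, f, K_c, K_p listed in the context, for all a < b the following identities hold: Γ(a, b) = e^{−Φ_q (b − a)} ( ∫₀^∞ f̃'(z + a) Ẑ(b − a − z) dz + (λ/Φ_q)(K_p − K_c) ), where Ẑ(x) := e^{Φ_q x} (1 + λ ∫₀^{max(x,0)} e^{−Φ_q z} W(z) dz); and, writing Γ̃(a, b) := e^{Φ_q (b − a)} Γ(a, b), one has −λ γ(a, b) = e^{Φ_q (b − a)} ∂Γ(a, b)/∂b = −Φ_q Γ̃(a, b) + ∂Γ̃(a, b)/∂b. -/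

import Mathlib

open MeasureTheory Filter Set Real

noncomputable section

/-- Tilted inventory-cost derivative integrand against the scale function:
`ρ_a(b) = ∫_a^b g(y) W(b - y) dy`. -/
def rho (W g : ℝ → ℝ) (a b : ℝ) : ℝ :=
  ∫ y in a..b, g y * W (b - y)

/-- `Γ(a, b)` of the paper (display (Gamma)). -/
def Gam (lam Phiq Kp Kc : ℝ) (W g : ℝ → ℝ) (a b : ℝ) : ℝ :=
  (∫ y in Set.Ioi (0:ℝ), Real.exp (-Phiq * y) * g (y + a)) +
    lam * (∫ y in (0:ℝ)..(b - a), Real.exp (-Phiq * y) * rho W g a (y + a)) +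
    lam / Phiq * Real.exp (-Phiq * (b - a)) * (Kp - Kc)

/-- `Γ₁(a) = Γ(a, a+)`. -/
def Gam1 (lam Phiq Kp Kc : ℝ) (g : ℝ → ℝ) (a : ℝ) : ℝ :=
  (∫ y in Set.Ioi (0:ℝ), Real.exp (-Phiq * y) * g (y + a)) + lam / Phiq * (Kp - Kc)

/-- `Γ₂(a) = lim_{b→∞} Γ(a,b)/Θ(b-a)`. -/
def Gam2 (Phiql : ℝ) (g : ℝ → ℝ) (a : ℝ) : ℝ :=
  ∫ y in Set.Ioi (0:ℝ), Real.exp (-Phiql * y) * g (y + a)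

/-- `Θ(x) = Θ^{(q+λ)}(x, Φ(q))`. -/
def Theta (lam Phiq : ℝ) (W : ℝ → ℝ) (x : ℝ) : ℝ :=
  1 + lam * (∫ y in (0:ℝ)..x, Real.exp (-Phiq * y) * W y)

/-- `γ(a,b) = -ρ_a(b) + K_p - K_c`. -/
def gam (Kp Kc : ℝ) (W g : ℝ → ℝ) (a b : ℝ) : ℝ :=
  -(rho W g a b) + Kp - Kc

/-- `Z(x) = Z^{(q+λ)}(x) = 1 + (q+λ)∫₀^{x ∨ 0} W(y) dy`. -/
def Zfun (q lam : ℝ) (W : ℝ → ℝ) (x : ℝ) : ℝ :=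
  1 + (q + lam) * (∫ y in (0:ℝ)..(max x 0), W y)

/-- Second scale function `Ẑ(x) = Z^{(q+λ)}(x, Φ(q))`. -/
def Zhat (lam Phiq : ℝ) (W : ℝ → ℝ) (x : ℝ) : ℝ :=
  Real.exp (Phiq * x) *
    (1 + lam * (∫ z in (0:ℝ)..(max x 0), Real.exp (-Phiq * z) * W z))

theorem ConvexOn.monotone_of_hasDerivWithinAt_Ici {f f' : ℝ → ℝ} (hf : ConvexOn ℝ Set.univ f)
    (hf' : ∀ x : ℝ, HasDerivWithinAt f (f' x) (Set.Ici x) x) : Monotone f' := by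
  have h : f' = fun x => derivWithin f (Set.Ioi x) x := by
    funext x
    exact ((hf' x).Ioi_of_Ici.derivWithin (uniqueDiffWithinAt_Ioi x)).symm
  rw [h]
  simpa [monotoneOn_univ] using hf.monotoneOn_rightDeriv

theorem ConvexOn.rightDeriv_isBigO_exp {f f' : ℝ → ℝ} (hf : ConvexOn ℝ Set.univ f)
    (hf' : ∀ x : ℝ, HasDerivWithinAt f (f' x) (Set.Ici x) x) {N : ℕ}
    (hN : f =O[atTop] fun x : ℝ => x ^ N) {c : ℝ} (hc : 0 < c) :
    f' =O[atTop] fun x => Real.exp (c * x) := by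
  have hfe : f =O[atTop] fun x => Real.exp (c * x) :=
    hN.trans (isLittleO_pow_exp_pos_mul_atTop N hc).isBigO
  have hfe1 : (fun x => f (x + 1)) =O[atTop] fun x => Real.exp (c * x) := by
    have h1 := hfe.comp_tendsto (tendsto_atTop_add_const_right atTop (1 : ℝ) tendsto_id)
    refine h1.trans (Asymptotics.IsBigO.of_bound (Real.exp c) (Eventually.of_forall fun x => ?_))
    simp only [Function.comp, id, Real.norm_eq_abs, Real.abs_exp, ← Real.exp_add]
    exact (congrArg Real.exp (by ring)).le
  have hconst : (fun _ : ℝ => f' 0) =O[atTop] fun x => Real.exp (c * x) := by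
    refine Asymptotics.IsBigO.of_bound |f' 0| ?_
    filter_upwards [eventually_ge_atTop 0] with x hx
    simp only [Real.norm_eq_abs, Real.abs_exp]
    exact le_mul_of_one_le_right (abs_nonneg _) (Real.one_le_exp (by positivity))
  refine Asymptotics.IsBigO.trans ?_ ((hconst.norm_left.add hfe1.norm_left).add hfe.norm_left)
  refine Asymptotics.IsBigO.of_bound 1 ?_
  filter_upwards [eventually_ge_atTop 0] with x hx
  have hlow : f' 0 ≤ f' x := hf.monotone_of_hasDerivWithinAt_Ici hf' hx
  have hup : f' x ≤ slope f x (x + 1) :=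
    hf.le_slope_of_hasDerivWithinAt_Ioi (Set.mem_univ _) (Set.mem_univ _) (by linarith)
      (hf' x).Ioi_of_Ici
  rw [slope_def_field, add_sub_cancel_left, div_one] at hup
  simp only [Real.norm_eq_abs, one_mul]
  refine le_trans ?_ (le_abs_self _)
  have h1 := neg_abs_le (f' 0)
  have h2 := le_abs_self (f (x + 1))
  have h3 := neg_abs_le (f x)
  rw [abs_le]
  constructor <;> linarith [abs_nonneg (f' 0), abs_nonneg (f (x + 1)), abs_nonneg (f x)]

theorem Monotone.integrableOn_exp_neg_mul {h : ℝ → ℝ} (hh : Monotone h) {p c : ℝ} (hcp : c < p)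
    (hO : h =O[atTop] fun x => Real.exp (c * x)) :
    IntegrableOn (fun y => Real.exp (-p * y) * h y) (Set.Ioi 0) := by
  rw [← integrableOn_Ici_iff_integrableOn_Ioi]
  have hloc : LocallyIntegrableOn (fun y => Real.exp (-p * y) * h y) (Set.Ici 0) :=
    (hh.locallyIntegrable.locallyIntegrableOn _).continuousOn_mul
      (by fun_prop) isClosed_Ici.isLocallyClosed
  refine hloc.integrableOn_of_isBigO_atTop (g := fun y => Real.exp (-(p - c) * y)) ?_
    ⟨Set.Ioi 0, Ioi_mem_atTop 0, exp_neg_integrableOn_Ioi 0 (sub_pos.2 hcp)⟩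
  refine ((Asymptotics.isBigO_refl (fun y => Real.exp (-p * y)) atTop).mul hO).congr_right
    fun y => ?_
  rw [← Real.exp_add]
  ring_nf

theorem continuous_integral_mul_comp_sub {h W : ℝ → ℝ} (hh : Monotone h) (hW : Monotone W)
    (hW0 : ∀ x < (0 : ℝ), W x = 0) (hWcont : ContinuousOn W (Set.Ici 0)) (hWnn : ∀ x, 0 ≤ W x)
    {T : ℝ} (hT : 0 ≤ T) :
    Continuous fun y => ∫ z in (0 : ℝ)..T, h z * W (y - z) := by
  refine continuous_iff_continuousAt.2 fun y => ?_
  refine intervalIntegral.continuousAt_of_dominated_interval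
    (bound := fun z => |h z| * W (y + 1)) ?_ ?_ ?_ ?_
  · refine Eventually.of_forall fun x => ?_
    exact (hh.measurable.mul
      (hW.measurable.comp (measurable_const.sub measurable_id))).aestronglyMeasurable
  · filter_upwards [Iio_mem_nhds (lt_add_one y)] with x hx
    refine Eventually.of_forall fun z hz => ?_
    rw [Set.uIoc_of_le hT] at hz
    rw [norm_mul, Real.norm_eq_abs, Real.norm_eq_abs, abs_of_nonneg (hWnn _)]
    exact mul_le_mul_of_nonneg_left (hW (by linarith [hz.1, Set.mem_Iio.1 hx])) (abs_nonneg _)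
  · exact hh.intervalIntegrable.abs.mul_const _
  · filter_upwards [compl_mem_ae_iff.2 (measure_singleton y)] with z hz _
    refine continuousAt_const.mul ?_
    have hWat : ContinuousAt W (y - z) := by
      rcases lt_or_gt_of_ne (sub_ne_zero.2 (Ne.symm hz) : y - z ≠ 0) with hlt | hgt
      · refine (continuousAt_const (y := (0 : ℝ))).congr ?_
        filter_upwards [Iio_mem_nhds hlt] with u hu using (hW0 u hu).symm
      · exact hWcont.continuousAt (Ici_mem_nhds hgt)
    exact ContinuousAt.comp (f := fun x => x - z) hWat (by fun_prop)

theorem integral_mul_comp_sub_eq {h W : ℝ → ℝ} (hW0 : ∀ x < (0 : ℝ), W x = 0)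
    {y T : ℝ} (hy : 0 ≤ y) (hyT : y ≤ T) :
    ∫ z in (0 : ℝ)..y, h z * W (y - z) = ∫ z in (0 : ℝ)..T, h z * W (y - z) := by
  rw [intervalIntegral.integral_of_le hy, intervalIntegral.integral_of_le (hy.trans hyT)]
  refine (setIntegral_eq_of_subset_of_forall_sdiff_eq_zero measurableSet_Ioc
    (Set.Ioc_subset_Ioc_right hyT) fun z hz => ?_).symm
  have : y < z := by
    by_contra hzy
    exact hz.2 ⟨hz.1.1, not_lt.1 hzy⟩
  rw [hW0 _ (sub_neg.2 this), mul_zero]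

theorem integral_exp_mul_integral_mul_comp_sub {h W : ℝ → ℝ} (hh : Monotone h) (hW : Monotone W)
    (hW0 : ∀ x < (0 : ℝ), W x = 0) (p : ℝ) {T : ℝ} (hT : 0 ≤ T) :
    ∫ y in (0 : ℝ)..T, Real.exp (-p * y) * ∫ z in (0 : ℝ)..T, h z * W (y - z) =
      ∫ z in (0 : ℝ)..T, Real.exp (-p * z) * h z *
        ∫ u in (0 : ℝ)..(T - z), Real.exp (-p * u) * W u := by
  simp_rw [← intervalIntegral.integral_const_mul]
  rw [intervalIntegral_intervalIntegral_swap]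
  · refine intervalIntegral.integral_congr fun z hz => ?_
    rw [Set.uIcc_of_le hT] at hz
    have hshift := intervalIntegral.integral_comp_sub_right (a := 0) (b := T)
      (fun u => Real.exp (-p * z) * h z * (Real.exp (-p * u) * W u)) z
    have hzero : ∫ u in (0 - z)..(T - z), Real.exp (-p * z) * h z * (Real.exp (-p * u) * W u) =
        ∫ u in (0 : ℝ)..(T - z), Real.exp (-p * z) * h z * (Real.exp (-p * u) * W u) := by
      rw [intervalIntegral.integral_of_le (by linarith),
        intervalIntegral.integral_of_le (by linarith [hz.2])]
      refine setIntegral_eq_of_subset_of_ae_sdiff_eq_zero measurableSet_Ioc.nullMeasurableSet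
        (Set.Ioc_subset_Ioc_left (by linarith [hz.1])) ?_
      filter_upwards [compl_mem_ae_iff.2 (measure_singleton (0 : ℝ))] with u hu0 hu
      have hneg : u < 0 := by
        refine lt_of_le_of_ne ?_ hu0
        by_contra! hpos
        exact hu.2 ⟨hpos, hu.1.2⟩
      rw [hW0 u hneg, mul_zero, mul_zero]
    have hmul : ∫ y in (0 : ℝ)..T, Real.exp (-p * y) * (h z * W (y - z)) =
        ∫ y in (0 : ℝ)..T, Real.exp (-p * z) * h z * (Real.exp (-p * (y - z)) * W (y - z)) := by
      refine intervalIntegral.integral_congr fun y _ => ?_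
      have : Real.exp (-p * y) = Real.exp (-p * z) * Real.exp (-p * (y - z)) := by
        rw [← Real.exp_add]; ring_nf
      simp only [this]
      ring
    rw [hmul, hshift, hzero]
  · refine IntegrableOn.of_bound
      (C := Real.exp (|p| * T) * (max |h 0| |h T| * max |W (-T)| |W T|)) ?_ ?_ ?_
    · rw [Set.uIoc_of_le hT, Measure.volume_eq_prod, Measure.prod_prod]
      exact ENNReal.mul_lt_top (by simp) (by simp)
    · refine Measurable.aestronglyMeasurable ?_
      have h1 : Measurable fun x : ℝ × ℝ => h x.2 := hh.measurable.comp measurable_snd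
      have h2 : Measurable fun x : ℝ × ℝ => W (x.1 - x.2) :=
        hW.measurable.comp (measurable_fst.sub measurable_snd)
      have h3 : Measurable fun x : ℝ × ℝ => Real.exp (-p * x.1) := by fun_prop
      exact h3.mul (h1.mul h2)
    · filter_upwards [ae_restrict_mem (measurableSet_uIoc.prod measurableSet_uIoc)] with x hx
      rw [Set.uIoc_of_le hT] at hx
      obtain ⟨⟨hx1, hx2⟩, hx3, hx4⟩ := hx
      simp only [Function.uncurry, norm_mul, Real.norm_eq_abs, Real.abs_exp]
      refine mul_le_mul (Real.exp_le_exp.2 ?_) (mul_le_mul ?_ ?_ (abs_nonneg _) (by positivity))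
        (by positivity) (Real.exp_nonneg _)
      · calc -p * x.1 ≤ |p| * x.1 := by gcongr; exact neg_le_abs p
          _ ≤ |p| * T := by gcongr
      · exact abs_le_max_abs_abs (hh hx3.le) (hh hx4)
      · exact abs_le_max_abs_abs (hW (by linarith)) (hW (by linarith))

theorem rho_add_eq (W g : ℝ → ℝ) (a y : ℝ) :
    rho W g a (y + a) = ∫ z in (0 : ℝ)..y, g (z + a) * W (y - z) := by
  have h := intervalIntegral.integral_comp_add_right (a := 0) (b := y)
    (fun x => g x * W (y + a - x)) a
  rw [zero_add] at h
  rw [rho, ← h]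
  simp only [add_sub_add_right_eq_sub]

theorem Gam_eq_of_le {W g : ℝ → ℝ} (hW0 : ∀ x < (0 : ℝ), W x = 0) (lam p Kp Kc : ℝ)
    {a t T : ℝ} (hat : a ≤ t) (htT : t - a ≤ T) :
    Gam lam p Kp Kc W g a t = (∫ y in Set.Ioi (0 : ℝ), Real.exp (-p * y) * g (y + a)) +
      lam * (∫ y in (0 : ℝ)..(t - a),
        Real.exp (-p * y) * ∫ z in (0 : ℝ)..T, g (z + a) * W (y - z)) +
      lam / p * Real.exp (-p * (t - a)) * (Kp - Kc) := by
  rw [Gam]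
  congr 3
  refine intervalIntegral.integral_congr fun y hy => ?_
  rw [Set.uIcc_of_le (sub_nonneg.2 hat)] at hy
  simp only [rho_add_eq]
  rw [integral_mul_comp_sub_eq (h := fun z => g (z + a)) hW0 hy.1 (hy.2.trans htT)]

theorem integral_mul_Zhat {W h : ℝ → ℝ} (hh : Monotone h) (hW : Monotone W) (lam p : ℝ)
    (hint : IntegrableOn (fun y => Real.exp (-p * y) * h y) (Set.Ioi 0)) {T : ℝ} (hT : 0 ≤ T) :
    Real.exp (-p * T) * (∫ z in Set.Ioi (0 : ℝ), h z * Zhat lam p W (T - z)) =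
      (∫ y in Set.Ioi (0 : ℝ), Real.exp (-p * y) * h y) +
        lam * ∫ z in (0 : ℝ)..T, Real.exp (-p * z) * h z *
          ∫ u in (0 : ℝ)..(T - z), Real.exp (-p * u) * W u := by
  set I : ℝ → ℝ := fun x => ∫ u in (0 : ℝ)..x, Real.exp (-p * u) * W u with hI
  have hIcont : Continuous I := intervalIntegral.continuous_primitive
    (fun c d => hW.intervalIntegrable.continuousOn_mul (by fun_prop)) 0
  set k : ℝ → ℝ := fun z => Real.exp (-p * z) * h z * I (max (T - z) 0) with hk
  have hkzero : ∀ z ∈ Set.Ioi (0 : ℝ) \ Set.Ioc 0 T, k z = 0 := by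
    intro z hz
    have hTz : T - z ≤ 0 := by
      by_contra! hpos
      exact hz.2 ⟨hz.1, by linarith⟩
    simp [hk, hI, max_eq_right hTz]
  have hkIoc : IntegrableOn k (Set.Ioc 0 T) := by
    rw [← intervalIntegrable_iff_integrableOn_Ioc_of_le hT]
    exact (hh.intervalIntegrable.continuousOn_mul (by fun_prop)).mul_continuousOn
      (hIcont.comp (by fun_prop)).continuousOn
  have hkIoi : IntegrableOn k (Set.Ioi 0) :=
    hkIoc.of_forall_sdiff_eq_zero measurableSet_Ioi hkzero
  have hkint : ∫ z in Set.Ioi (0 : ℝ), k z =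
      ∫ z in (0 : ℝ)..T, Real.exp (-p * z) * h z * I (T - z) := by
    rw [setIntegral_eq_of_subset_of_forall_sdiff_eq_zero measurableSet_Ioi
      Set.Ioc_subset_Ioi_self hkzero, ← intervalIntegral.integral_of_le hT]
    refine intervalIntegral.integral_congr fun z hz => ?_
    rw [Set.uIcc_of_le hT] at hz
    simp only [hk, max_eq_left (sub_nonneg.2 hz.2)]
  rw [← hkint, ← integral_const_mul, ← integral_const_mul,
    ← integral_add hint (hkIoi.const_mul lam)]
  refine integral_congr_ae (Eventually.of_forall fun z => ?_)
  have hexp : Real.exp (-p * z) = Real.exp (-p * T) * Real.exp (p * (T - z)) := by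
    rw [← Real.exp_add]; ring_nf
  simp only [Zhat, hk, hI, hexp]
  ring

theorem hasDerivAt_Gam {W g : ℝ → ℝ} (hg : Monotone g) (hW : Monotone W)
    (hW0 : ∀ x < (0 : ℝ), W x = 0) (hWcont : ContinuousOn W (Set.Ici 0)) (hWnn : ∀ x, 0 ≤ W x)
    (lam Kp Kc : ℝ) {p : ℝ} (hp : p ≠ 0) {a b : ℝ} (hab : a < b) :
    HasDerivAt (fun t => Gam lam p Kp Kc W g a t)
      (-(lam * gam Kp Kc W g a b) * Real.exp (-p * (b - a))) b := by
  have hh : Monotone fun z => g (z + a) := fun x y hxy => hg (by linarith)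
  have hT : 0 ≤ b - a + 1 := by linarith
  set F : ℝ → ℝ := fun y => Real.exp (-p * y) *
    ∫ z in (0 : ℝ)..(b - a + 1), g (z + a) * W (y - z) with hF
  have hFcont : Continuous F :=
    (by fun_prop : Continuous fun y : ℝ => Real.exp (-p * y)).mul
      (continuous_integral_mul_comp_sub hh hW hW0 hWcont hWnn hT)
  have hFb : F (b - a) = Real.exp (-p * (b - a)) * rho W g a b := by
    have hr := rho_add_eq W g a (b - a)
    rw [sub_add_cancel] at hr
    rw [hr, integral_mul_comp_sub_eq (h := fun z => g (z + a)) hW0 (sub_nonneg.2 hab.le)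
      (le_add_of_nonneg_right zero_le_one)]
  have hsub : HasDerivAt (fun t : ℝ => t - a) 1 b := (hasDerivAt_id b).sub_const a
  have hint : HasDerivAt (fun t => ∫ y in (0 : ℝ)..(t - a), F y) (F (b - a) * 1) b :=
    HasDerivAt.comp (h := fun t => t - a) b
      (hFcont.integral_hasStrictDerivAt 0 (b - a)).hasDerivAt hsub
  have hexp : HasDerivAt (fun t => Real.exp (-p * (t - a)))
      (Real.exp (-p * (b - a)) * (-p * 1)) b := (hsub.const_mul (-p)).exp
  have hmain := ((hint.const_mul lam).const_add
    (∫ y in Set.Ioi (0 : ℝ), Real.exp (-p * y) * g (y + a))).add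
      ((hexp.const_mul (lam / p)).mul_const (Kp - Kc))
  refine (hmain.congr_deriv ?_).congr_of_eventuallyEq ?_
  · rw [hFb, gam]
    field_simp
    ring
  · filter_upwards [Ioo_mem_nhds hab (lt_add_one b)] with t ht
    exact Gam_eq_of_le hW0 lam p Kp Kc ht.1.le (by linarith [ht.2])

/-- Lemma 5.8 (alternative forms of Γ and γ) of the paper. -/
theorem Gamma_alternative_form
    (q lam Phiq Phiql : ℝ) (hq : 0 < q) (hlam : 0 < lam)
    (hPhiq : 0 < Phiq) (hPhi : Phiq < Phiql)
    (W : ℝ → ℝ)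
    (hW0 : ∀ x < (0:ℝ), W x = 0)
    (hWnn : ∀ x ≥ (0:ℝ), 0 ≤ W x)
    (hWcont : ContinuousOn W (Set.Ici 0))
    (hWmono : StrictMonoOn W (Set.Ici 0))
    (hWC1 : ContDiffOn ℝ 1 W (Set.Ioi 0))
    (f f' : ℝ → ℝ)
    (hf_conv : ConvexOn ℝ Set.univ f)
    (hf_deriv : ∀ x : ℝ, HasDerivWithinAt f (f' x) (Set.Ici x) x)
    (hf_pw : ∃ E : Set ℝ, E.Countable ∧ ∀ x ∉ E, ContinuousAt f' x)
    (hf_growth : ∃ C M : ℝ, ∃ N : ℕ, 0 < C ∧ 0 < M ∧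
      ∀ x : ℝ, M < |x| → |f x| ≤ C * |x| ^ N)
    (Kc Kp : ℝ) (hK : Kp < Kc)
    (g : ℝ → ℝ) (hg : ∀ x : ℝ, g x = f' x + q * Kc + lam * (Kc - Kp))
    :
    ∀ a b : ℝ, a < b →
      Gam lam Phiq Kp Kc W g a b =
        Real.exp (-Phiq * (b - a)) *
          ((∫ z in Set.Ioi (0:ℝ), g (z + a) * Zhat lam Phiq W (b - a - z)) +
            lam / Phiq * (Kp - Kc)) ∧
      HasDerivAt (fun t => Gam lam Phiq Kp Kc W g a t)
        (-(lam * gam Kp Kc W g a b) * Real.exp (-Phiq * (b - a))) b ∧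
      HasDerivAt (fun t => Real.exp (Phiq * (t - a)) * Gam lam Phiq Kp Kc W g a t)
        (Phiq * (Real.exp (Phiq * (b - a)) * Gam lam Phiq Kp Kc W g a b)
          - lam * gam Kp Kc W g a b) b := by
  intro a b hab
  have hWall : ∀ x, 0 ≤ W x := fun x => by
    rcases lt_or_ge x 0 with hx | hx
    · exact (hW0 x hx).ge
    · exact hWnn x hx
  have hW : Monotone W := fun x y hxy => by
    rcases lt_or_ge x 0 with hx | hx
    · exact (hW0 x hx).trans_le (hWall y)
    · exact hWmono.monotoneOn hx (hx.trans hxy) hxy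
  have hf'mono : Monotone f' := hf_conv.monotone_of_hasDerivWithinAt_Ici hf_deriv
  have hgmono : Monotone g := fun x y hxy => by
    rw [hg, hg]
    linarith [hf'mono hxy]
  have hc : 0 < Phiq / 2 := half_pos hPhiq
  have hgO : g =O[atTop] fun x => Real.exp (Phiq / 2 * x) := by
    obtain ⟨C, M, N, -, -, hCM⟩ := hf_growth
    have hfO : f =O[atTop] fun x : ℝ => x ^ N := by
      refine Asymptotics.IsBigO.of_bound C ?_
      filter_upwards [eventually_gt_atTop M] with x hx
      rw [Real.norm_eq_abs, Real.norm_eq_abs, abs_pow]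
      exact hCM x (hx.trans_le (le_abs_self x))
    have hconst : (fun _ : ℝ => q * Kc + lam * (Kc - Kp)) =O[atTop]
        fun x => Real.exp (Phiq / 2 * x) :=
      (Asymptotics.isBigO_const_const _ one_ne_zero _).trans
        ((isLittleO_pow_exp_pos_mul_atTop 0 hc).isBigO.congr_left (f₂ := fun _ => (1 : ℝ))
          fun x => pow_zero x)
    refine ((hf_conv.rightDeriv_isBigO_exp hf_deriv hfO hc).add hconst).congr_left fun x => ?_
    rw [hg, add_assoc]
  have hhmono : Monotone fun z => g (z + a) := fun x y hxy => hgmono (by linarith)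
  have hhO : (fun z => g (z + a)) =O[atTop] fun x => Real.exp (Phiq / 2 * x) := by
    refine (hgO.comp_tendsto (tendsto_atTop_add_const_right atTop a tendsto_id)).trans
      (Asymptotics.IsBigO.of_bound (Real.exp (Phiq / 2 * a)) (Eventually.of_forall fun x => ?_))
    simp only [Function.comp, id, Real.norm_eq_abs, Real.abs_exp, ← Real.exp_add]
    exact (congrArg Real.exp (by ring)).le
  have hderiv := hasDerivAt_Gam hgmono hW hW0 hWcont hWall lam Kp Kc hPhiq.ne' hab
  refine ⟨?_, hderiv, ?_⟩
  · have hT : 0 ≤ b - a := sub_nonneg.2 hab.le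
    have hint := hhmono.integrableOn_exp_neg_mul (half_lt_self hPhiq) hhO
    rw [Gam_eq_of_le hW0 lam Phiq Kp Kc hab.le le_rfl, mul_add,
      integral_mul_Zhat hhmono hW lam Phiq hint hT,
      integral_exp_mul_integral_mul_comp_sub hhmono hW hW0 Phiq hT]
    ring
  · have hexp : HasDerivAt (fun t => Real.exp (Phiq * (t - a)))
        (Real.exp (Phiq * (b - a)) * (Phiq * 1)) b :=
      (((hasDerivAt_id b).sub_const a).const_mul Phiq).exp
    refine (hexp.mul hderiv).congr_deriv ?_
    have hcancel : Real.exp (Phiq * (b - a)) * Real.exp (-Phiq * (b - a)) = 1 := by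
      rw [← Real.exp_add]
      simp
    linear_combination (-(lam * gam Kp Kc W g a b)) * hcancel
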